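/- Let R be a unital ℂ-algebra with a conjugate-linear involutive anti-automorphism r ↦ r*, containing elements z₁,z₂,z₃,z₄ with z_j z_l = η_{jl} z_l z_j and z_j z_l* = η_{lj} z_l* z_j, and elements M^α_{ab} (α ∈ {1,…,4}, a ∈ {1,…,n}, b ∈ {1,…,k}) such that: every M^α_{ab} and every (M^α_{ab})* commutes with every z_γ and every z_γ*; M^α_{ab} M^β_{cd} = η_{βα} M^β_{cd} M^α_{ab}; and M^α_{ab} (M^β_{cd})* = η_{αβ} (M^β_{cd})* M^α_{ab}, for all indices. Let σ_z be the n×k matrix with entries (σ_z)_{ab} = Σ_α M^α_{ab} z_α and let ρ² := σ_z^★ σ_z (a k×k matrix over R). Then every entry of ρ² commutes with every entry of σ_z: (ρ²)_{μν} (σ_z)_{ab} = (σ_z)_{ab} (ρ²)_{μν} for all μ,ν ∈ {1,…,k}, a ∈ {1,…,n}, b ∈ {1,…,k}. -/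

import Mathlib

open Matrix

/-- The deformation parameter μ = exp(πiθ). -/
noncomputable def muDef (θ : ℝ) : ℂ := Complex.exp (Real.pi * Complex.I * θ)

/-- The 4×4 matrix of deformation parameters η. -/
noncomputable def etaDef (θ : ℝ) : Fin 4 → Fin 4 → ℂ :=
  ![![1, 1, starRingEnd ℂ (muDef θ), muDef θ],
    ![1, 1, muDef θ, starRingEnd ℂ (muDef θ)],
    ![muDef θ, starRingEnd ℂ (muDef θ), 1, 1],
    ![starRingEnd ℂ (muDef θ), muDef θ, 1, 1]]

theorem muDef_mul_conj (θ : ℝ) : muDef θ * starRingEnd ℂ (muDef θ) = 1 := by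
  rw [muDef, ← Complex.exp_conj, ← Complex.exp_add]
  simp

theorem etaDef_mul_swap (θ : ℝ) (j l : Fin 4) : etaDef θ j l * etaDef θ l j = 1 := by
  have h := muDef_mul_conj θ
  have h' := (mul_comm _ _).trans h
  fin_cases j <;> fin_cases l <;> simp [etaDef, h, h']

/-- If `x, y` commute up to `c`, `u, v` commute up to `d`, the two pairs commute with
each other crosswise, and `c * d = 1`, then `x * u` and `y * v` commute. -/
theorem Commute.mul_mul_of_smul_comm {K R : Type*} [CommSemiring K] [Semiring R] [Algebra K R]
    {x y u v : R} {c d : K} (hcd : c * d = 1) (hxy : x * y = c • (y * x))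
    (huv : u * v = d • (v * u)) (hyu : Commute y u) (hxv : Commute x v) :
    Commute (x * u) (y * v) := by
  calc x * u * (y * v) = x * y * (u * v) := by
        simp only [mul_assoc]
        rw [← mul_assoc u, ← hyu.eq, mul_assoc]
    _ = y * x * (v * u) := by
        rw [hxy, huv, smul_mul_smul_comm, hcd, one_smul]
    _ = y * v * (x * u) := by
        simp only [mul_assoc]
        rw [← mul_assoc x, hxv.eq, mul_assoc]

/-- Every entry of the matrix ρ² = σ_z^★ σ_z commutes with every entry
of σ_z, where (σ_z)_{ab} = Σ_α M^α_{ab} z_α. -/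
theorem stmt7 (θ : ℝ) (R : Type*) [Ring R] [Algebra ℂ R] [StarRing R] [StarModule ℂ R]
    (n k : ℕ) (z : Fin 4 → R)
    (hzz : ∀ j l, z j * z l = etaDef θ j l • (z l * z j))
    (hzs : ∀ j l, z j * star (z l) = etaDef θ l j • (star (z l) * z j))
    (M : Fin 4 → Matrix (Fin n) (Fin k) R)
    (hMz : ∀ γ a b δ, M γ a b * z δ = z δ * M γ a b)
    (hMzs : ∀ γ a b δ, M γ a b * star (z δ) = star (z δ) * M γ a b)
    (hMsz : ∀ γ a b δ, star (M γ a b) * z δ = z δ * star (M γ a b))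
    (hMszs : ∀ γ a b δ, star (M γ a b) * star (z δ) = star (z δ) * star (M γ a b))
    (hMM : ∀ γ δ a b c d, M γ a b * M δ c d = etaDef θ δ γ • (M δ c d * M γ a b))
    (hMMs : ∀ γ δ a b c d,
      M γ a b * star (M δ c d) = etaDef θ γ δ • (star (M δ c d) * M γ a b))
    (σ : Matrix (Fin n) (Fin k) R)
    (hσ : ∀ a b, σ a b = ∑ γ, M γ a b * z γ) :
    ∀ (i j : Fin k) (a : Fin n) (b : Fin k),
      (σᴴ * σ) i j * σ a b = σ a b * (σᴴ * σ) i j := by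
  intro i j a b
  have hcomm : ∀ a b c d, Commute (σ a b) (σ c d) := by
    intro a b c d
    rw [hσ a b, hσ c d]
    refine Commute.sum_left _ _ _ fun γ _ => Commute.sum_right _ _ _ fun δ _ => ?_
    exact Commute.mul_mul_of_smul_comm (etaDef_mul_swap θ δ γ) (hMM γ δ a b c d) (hzz γ δ)
      (hMz δ c d γ) (hMz γ a b δ)
  have hcomm_star : ∀ a b c d, Commute (σ a b) (star (σ c d)) := by
    intro a b c d
    rw [hσ a b, hσ c d, star_sum]
    refine Commute.sum_left _ _ _ fun γ _ => Commute.sum_right _ _ _ fun δ _ => ?_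
    rw [star_mul, ← hMszs]
    exact Commute.mul_mul_of_smul_comm (etaDef_mul_swap θ γ δ) (hMMs γ δ a b c d) (hzs γ δ)
      (hMsz δ c d γ) (hMzs γ a b δ)
  rw [Matrix.mul_apply]
  refine (Commute.sum_right _ _ _ fun c _ => ?_).symm.eq
  rw [conjTranspose_apply]
  exact (hcomm_star a b c i).mul_right (hcomm a b c j)
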